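/- Let (Ω, 𝒜, μ) be a probability space, let X : Ω → ℝ be measurable and integrable with X(ω) > 0 for μ-almost every ω, and suppose the function ω ↦ X(ω)⁻² is integrable with ∫ X⁻² dμ ≤ C for some real C ≥ 0. Let A be a measurable set and α a real number with μ(A) ≥ α. Then for every ε > 0 satisfying √ε + C·ε < α, one has ∫_A X dμ > ε. In particular, if α > 0 then there is a constant c > 0 depending only on α and C such that ∫_A X dμ ≥ c. -/

import Mathlib

open MeasureTheory

/-- Splitting `A` according to whether `X ≥ s` or `X < s` bounds the measure of `A` by Markov-type
terms in `X` and `X⁻²`. -/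
theorem measureReal_le_setIntegral_div_add_mul_integral_inv_sq
    {Ω : Type*} [MeasurableSpace Ω] {μ : Measure Ω} [IsFiniteMeasure μ] {X : Ω → ℝ}
    (hXint : Integrable X μ) (hXpos : ∀ᵐ ω ∂μ, 0 < X ω)
    (hX2int : Integrable (fun ω => (X ω ^ 2)⁻¹) μ) (A : Set Ω) {s : ℝ} (hs : 0 < s) :
    μ.real A ≤ (∫ ω in A, X ω ∂μ) / s + s ^ 2 * ∫ ω, (X ω ^ 2)⁻¹ ∂μ := by
  have hpt : ∀ᵐ ω ∂μ.restrict A, (1 : ℝ) ≤ X ω / s + s ^ 2 * (X ω ^ 2)⁻¹ := by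
    filter_upwards [ae_restrict_of_ae hXpos] with ω hω
    rcases le_or_gt s (X ω) with h | h
    · have h1 : 1 ≤ X ω / s := (one_le_div hs).2 h
      have h2 : 0 ≤ s ^ 2 * (X ω ^ 2)⁻¹ := by positivity
      linarith
    · have h1 : 1 ≤ s ^ 2 * (X ω ^ 2)⁻¹ := by
        rw [← div_eq_mul_inv, one_le_div (by positivity)]
        gcongr
      have h2 : 0 ≤ X ω / s := by positivity
      linarith
  have hX : Integrable (fun ω => X ω / s) (μ.restrict A) := hXint.restrict.div_const s
  have hX2 : Integrable (fun ω => s ^ 2 * (X ω ^ 2)⁻¹) (μ.restrict A) :=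
    hX2int.restrict.const_mul _
  calc μ.real A = ∫ _ in A, (1 : ℝ) ∂μ := by simp
    _ ≤ ∫ ω in A, (X ω / s + s ^ 2 * (X ω ^ 2)⁻¹) ∂μ :=
      integral_mono_ae (integrable_const _) (hX.add hX2) hpt
    _ = (∫ ω in A, X ω ∂μ) / s + s ^ 2 * ∫ ω in A, (X ω ^ 2)⁻¹ ∂μ := by
      rw [integral_add hX hX2, integral_div, integral_const_mul]
    _ ≤ _ := by
      gcongr _ + s ^ 2 * ?_
      exact setIntegral_le_integral hX2int (.of_forall fun ω => by positivity)

/-- The threshold can be chosen in terms of `C` and `α` alone. -/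
theorem exists_pos_sqrt_add_mul_lt (C : ℝ) {α : ℝ} (hα : 0 < α) :
    ∃ ε : ℝ, 0 < ε ∧ √ε + C * ε < α := by
  have hcont : Continuous fun ε : ℝ => √ε + C * ε := by fun_prop
  have hlt : ∀ᶠ ε in nhdsWithin (0 : ℝ) (Set.Ioi 0), √ε + C * ε < α :=
    (hcont.continuousAt.eventually_lt_const (by simpa using hα)).filter_mono
      nhdsWithin_le_nhds
  obtain ⟨ε, hε, hpos⟩ := (hlt.and eventually_mem_nhdsWithin).exists
  exact ⟨ε, hpos, hε⟩

/-- The quantitative core of display (1.4) and inequality (e:cool2) of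
Anantharaman–Sabri: if `X > 0` a.e. with `∫ X⁻² ≤ C` and `μ(A) ≥ α`, then
`∫_A X > ε` whenever `√ε + Cε < α`; in particular if `α > 0` then `∫_A X` is
bounded below by a positive constant. -/
theorem integral_lower_bound_of_inverse_moment
    {Ω : Type*} [MeasurableSpace Ω] (μ : Measure Ω) [IsProbabilityMeasure μ]
    (X : Ω → ℝ) (hXmeas : Measurable X)
    (hXint : Integrable X μ)
    (hXpos : ∀ᵐ ω ∂μ, 0 < X ω)
    (C : ℝ) (hC : 0 ≤ C)
    (hX2int : Integrable (fun ω => (X ω ^ 2)⁻¹) μ)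
    (hX2bound : ∫ ω, (X ω ^ 2)⁻¹ ∂μ ≤ C)
    (A : Set Ω) (hA : MeasurableSet A) (α : ℝ) (hα : α ≤ (μ A).toReal) :
    (∀ ε : ℝ, 0 < ε → Real.sqrt ε + C * ε < α → ε < ∫ ω in A, X ω ∂μ) ∧
      (0 < α → ∃ c : ℝ, 0 < c ∧ c ≤ ∫ ω in A, X ω ∂μ) := by
  have key : ∀ ε : ℝ, 0 < ε → Real.sqrt ε + C * ε < α → ε < ∫ ω in A, X ω ∂μ := by
    intro ε hε hlt
    by_contra! hle
    have hs : 0 < √ε := Real.sqrt_pos.2 hε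
    have hmeas : (μ A).toReal ≤ _ :=
      measureReal_le_setIntegral_div_add_mul_integral_inv_sq hXint hXpos hX2int A hs
    have h1 : (∫ ω in A, X ω ∂μ) / √ε ≤ √ε := by
      rw [div_le_iff₀ hs, Real.mul_self_sqrt hε.le]
      exact hle
    rw [Real.sq_sqrt hε.le] at hmeas
    have h2 := mul_le_mul_of_nonneg_left hX2bound hε.le
    linarith
  refine ⟨key, fun hα0 => ?_⟩
  obtain ⟨ε, hε, hlt⟩ := exists_pos_sqrt_add_mul_lt C hα0
  exact ⟨ε, hε, (key ε hε hlt).le⟩
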